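/- Let H be an m×n matrix over F_2 and let c be a nonzero codeword of the binary linear code with parity-check matrix H. Then the real vector x ∈ ℝ^n defined by x_i = 1 if c_i = 1 and x_i = 0 otherwise lies in the fundamental cone of H, and its AWGN pseudocodeword weight w(x) equals the Hamming weight of c. Consequently the minimal pseudocodeword weight of H satisfies w_min ≤ d_min. -/

import Mathlib

attribute [local instance 0] Classical.propDecidable

/-- The fundamental cone of `H`: all `x : ℝ^n` with `x i ≥ 0` for all `i`, and for every
row `j` and every `i` with `H j i = 1`, `x i ≤ ∑_{k ≠ i, H j k = 1} x k`. -/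
def fundamentalCone {m n : ℕ} (H : Matrix (Fin m) (Fin n) (ZMod 2)) :
    Set (Fin n → ℝ) :=
  {x | (∀ i, 0 ≤ x i) ∧
    ∀ (j : Fin m) (i : Fin n), H j i = 1 →
      x i ≤ ∑ k ∈ Finset.univ.filter (fun k => k ≠ i ∧ H j k = 1), x k}

/-- The AWGN pseudocodeword weight `w(x) = (∑ x i)² / (∑ (x i)²)`. -/
noncomputable def pweight {n : ℕ} (x : Fin n → ℝ) : ℝ :=
  (∑ i, x i) ^ 2 / ∑ i, x i ^ 2

theorem zmod_two_eq_one_of_ne_zero {a : ZMod 2} (h : a ≠ 0) : a = 1 :=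
  Fin.eq_one_of_ne_zero a h

theorem pweight_nonneg {n : ℕ} (x : Fin n → ℝ) : 0 ≤ pweight x :=
  div_nonneg (sq_nonneg _) (Finset.sum_nonneg fun _ _ => sq_nonneg _)

theorem indicator_mem_fundamentalCone {m n : ℕ} (H : Matrix (Fin m) (Fin n) (ZMod 2))
    (c : Fin n → ZMod 2) (hc : H.mulVec c = 0) :
    (fun i => if c i = 1 then (1 : ℝ) else 0) ∈ fundamentalCone H := by
  have hnonneg (i : Fin n) : 0 ≤ (if c i = 1 then (1 : ℝ) else 0) := by
    split_ifs <;> norm_num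
  refine ⟨hnonneg, fun j i hji => ?_⟩
  by_cases hi : c i = 1
  · obtain ⟨k, hki, hjk, hk⟩ : ∃ k, k ≠ i ∧ H j k = 1 ∧ c k = 1 := by
      by_contra! hno
      have hsum : ∑ k, H j k * c k = 0 := congrFun hc j
      rw [Finset.sum_eq_single i, hji, hi, one_mul] at hsum
      · exact one_ne_zero hsum
      · intro k _ hki
        by_contra hne
        exact hno k hki (zmod_two_eq_one_of_ne_zero (left_ne_zero_of_mul hne))
          (zmod_two_eq_one_of_ne_zero (right_ne_zero_of_mul hne))
      · simp
    have hle := Finset.single_le_sum (f := fun k => if c k = 1 then (1 : ℝ) else 0)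
      (fun k _ => hnonneg k)
      (Finset.mem_filter.mpr ⟨Finset.mem_univ k, hki, hjk⟩ :
        k ∈ Finset.univ.filter (fun k => k ≠ i ∧ H j k = 1))
    simpa [hi, hk] using hle
  · simp only [hi, if_false]
    exact Finset.sum_nonneg fun k _ => hnonneg k

theorem pweight_indicator {n : ℕ} (c : Fin n → ZMod 2) (hc0 : c ≠ 0) :
    pweight (fun i => if c i = 1 then (1 : ℝ) else 0) = (hammingNorm c : ℝ) := by
  have hsum : ∑ i, (if c i = 1 then (1 : ℝ) else 0) = hammingNorm c := by
    rw [Finset.sum_boole, hammingNorm]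
    congr 2
    ext i
    simp only [Finset.mem_filter, Finset.mem_univ, true_and]
    exact ⟨fun h => h ▸ one_ne_zero, zmod_two_eq_one_of_ne_zero⟩
  have hnorm : (hammingNorm c : ℝ) ≠ 0 :=
    Nat.cast_ne_zero.mpr (hammingNorm_ne_zero_iff.mpr hc0)
  simp only [pweight, ite_pow, one_pow, ne_eq, two_ne_zero, not_false_eq_true, zero_pow, hsum]
  field_simp

/-- Every nonzero codeword `c` of the binary linear code with parity-check matrix `H`,
viewed as the real 0/1-vector `x` with `x i = 1` iff `c i = 1`, lies in the fundamental
cone of `H` and has AWGN pseudocodeword weight equal to the Hamming weight of `c`.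
Consequently the minimal pseudocodeword weight `w_min` (the infimum of `pweight` over
nonzero vectors of the cone) is at most the weight of each nonzero codeword, i.e.
`w_min ≤ d_min`. -/
theorem stmt2 {m n : ℕ} (H : Matrix (Fin m) (Fin n) (ZMod 2))
    (c : Fin n → ZMod 2) (hc : H.mulVec c = 0) (hc0 : c ≠ 0) :
    (fun i => if c i = 1 then (1 : ℝ) else 0) ∈ fundamentalCone H ∧
    pweight (fun i => if c i = 1 then (1 : ℝ) else 0) = (hammingNorm c : ℝ) ∧
    sInf (pweight '' {x | x ∈ fundamentalCone H ∧ x ≠ 0}) ≤ (hammingNorm c : ℝ) := by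
  have hcone := indicator_mem_fundamentalCone H c hc
  have hweight := pweight_indicator c hc0
  refine ⟨hcone, hweight, ?_⟩
  rw [← hweight]
  refine csInf_le ⟨0, ?_⟩ ⟨_, ⟨hcone, ?_⟩, rfl⟩
  · rintro _ ⟨x, -, rfl⟩
    exact pweight_nonneg x
  · intro h0
    rw [h0] at hweight
    have : (hammingNorm c : ℝ) = 0 := by simpa [pweight] using hweight.symm
    exact hc0 (hammingNorm_eq_zero.mp (by exact_mod_cast this))
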